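/- For every vector u ∈ ℝ³ and every diagonal matrix D = diag(d₁,d₂,d₃) with real entries, hat(u)ᵀ·hat(u)·D − D·hat(u)ᵀ·hat(u) = hat(u × (D·u)). -/

import Mathlib

open Matrix

/-- The hat map: for `u ∈ ℝ³`, `hat u` is the skew-symmetric matrix with
`hat u *ᵥ v = u × v` for all `v`. -/
def hat (u : Fin 3 → ℝ) : Matrix (Fin 3) (Fin 3) ℝ :=
  !![0, -u 2, u 1; u 2, 0, -u 0; -u 1, u 0, 0]

/-- For every `u ∈ ℝ³` and every diagonal matrix `D = diag (d₁, d₂, d₃)`,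
`(hat u)ᵀ * hat u * D - D * ((hat u)ᵀ * hat u) = hat (u × (D *ᵥ u))`. -/
theorem hatT_hat_diagonal_comm (u d : Fin 3 → ℝ) :
    (hat u)ᵀ * hat u * Matrix.diagonal d - Matrix.diagonal d * ((hat u)ᵀ * hat u) =
      hat (crossProduct u ((Matrix.diagonal d).mulVec u)) := by
  ext i j
  fin_cases i <;> fin_cases j <;>
    simp [hat, crossProduct, Matrix.mul_apply, Matrix.mulVec_diagonal, Fin.sum_univ_three] <;> ring
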